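/- arXiv:math/9909022 — 2 statements merged into one kernel-verified Lean document; each statement's English description precedes it below -/
import Mathlib

section
/- Let D be a Γ-invariant linear operator on compactly supported sections of finite propagation speed, let Γ' be a finite-index normal subgroup of Γ, and let D_{Γ'} be the pushdown of D. Then for every z ∈ ℂ and all x, y ∈ Y, the kernel of the exponential e^{zD_{Γ'}} is given by ⟨x|e^{zD_{Γ'}}|y⟩ = Σ_{γ∈Γ'} ρ(γ)⁻¹ ⟨γx|e^{zD}|y⟩, where ⟨x|e^{zD_{Γ'}}|y⟩ := Σ_{n≥0}(zⁿ/n!)⟨x|D_{Γ'}ⁿ|y⟩ and ⟨x|e^{zD}|y⟩ := Σ_{n≥0}(zⁿ/n!)⟨x|Dⁿ|y⟩, all series being absolutely convergent. -/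
open scoped BigOperators
open Filter

noncomputable section

variable {Y Γ V : Type*}

section Defs

variable [Group Γ] [MulAction Γ Y]
variable [NormedAddCommGroup V] [InnerProductSpace ℂ V]

/-- The action of `γ ∈ Γ` on compactly (= finitely) supported sections
`φ : Y →₀ V`, given by `(γ · φ)(y) = ρ(γ) φ(γ⁻¹ • y)`. -/
def secAct (ρ : Γ →* (V ≃ₗᵢ[ℂ] V)) (γ : Γ) (φ : Y →₀ V) : Y →₀ V :=
  Finsupp.equivMapDomain (MulAction.toPerm γ) (φ.mapRange (ρ γ) ((ρ γ).map_zero))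

/-- A linear operator on compactly supported sections is `Γ`-invariant if it
commutes with the action of `Γ`. -/
def IsEquivariantOp (ρ : Γ →* (V ≃ₗᵢ[ℂ] V)) (D : (Y →₀ V) →ₗ[ℂ] (Y →₀ V)) : Prop :=
  ∀ (γ : Γ) (φ : Y →₀ V), D (secAct ρ γ φ) = secAct ρ γ (D φ)

/-- The kernel `⟨x|D|y⟩ ∈ End(V)` of an operator `D`, characterized by
`⟨x|D|y⟩ v = (D δ_{y,v})(x)`. -/
def kernelOf (D : (Y →₀ V) →ₗ[ℂ] (Y →₀ V)) (x y : Y) : V →ₗ[ℂ] V :=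
  (Finsupp.lapply x) ∘ₗ D ∘ₗ (Finsupp.lsingle y)

/-- `D` has finite propagation speed `≤ R`:
`supp (Dφ) ⊆ U_R(supp φ) = {x | ∃ y ∈ supp φ, d(x,y) ≤ R}`. -/
def HasPropSpeed [MetricSpace Y] (D : (Y →₀ V) →ₗ[ℂ] (Y →₀ V)) (R : ℝ) : Prop :=
  ∀ (φ : Y →₀ V) (x : Y), D φ x ≠ 0 → ∃ y ∈ φ.support, dist x y ≤ R

/-- A set of representatives of the orbits of a group `G` acting on `Y`:
it contains exactly one point of every orbit. -/
def IsRepSet (G : Type*) [Group G] [MulAction G Y] (S : Set Y) : Prop :=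
  ∀ y : Y, ∃! s, s ∈ S ∧ s ∈ MulAction.orbit G y

/-- The space `W_{Γ'}` of `Γ'`-equivariant functions `f : Y → V`,
i.e. `f(γ • y) = ρ(γ) f(y)` for all `γ ∈ Γ'`. -/
def equivSubmodule (ρ : Γ →* (V ≃ₗᵢ[ℂ] V)) (Γ' : Subgroup Γ) : Submodule ℂ (Y → V) where
  carrier := {f | ∀ (γ : Γ') (y : Y), f ((γ : Γ) • y) = ρ (γ : Γ) (f y)}
  add_mem' := by intro f g hf hg γ y; simp only [Pi.add_apply, hf γ y, hg γ y, map_add]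
  zero_mem' := by intro γ y; simp
  smul_mem' := by intro c f hf γ y; simp only [Pi.smul_apply, hf γ y, map_smul]

/-- The summation map `S_{Γ'} φ (y) = Σ_{γ ∈ Γ'} ρ(γ)⁻¹ φ(γ • y)`. -/
def smap (ρ : Γ →* (V ≃ₗᵢ[ℂ] V)) (Γ' : Subgroup Γ) (φ : Y →₀ V) : Y → V :=
  fun y => ∑ᶠ γ : Γ', ρ ((γ : Γ)⁻¹) (φ ((γ : Γ) • y))

/-- `DG` is the pushdown of `D` to `W_{Γ'}`, i.e. `DG ∘ S_{Γ'} = S_{Γ'} ∘ D`. -/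
def IsPushdown (ρ : Γ →* (V ≃ₗᵢ[ℂ] V)) (Γ' : Subgroup Γ)
    (D : (Y →₀ V) →ₗ[ℂ] (Y →₀ V))
    (DG : equivSubmodule (Y := Y) ρ Γ' →ₗ[ℂ] equivSubmodule (Y := Y) ρ Γ') : Prop :=
  ∀ (w : equivSubmodule (Y := Y) ρ Γ') (φ : Y →₀ V),
    (w : Y → V) = smap ρ Γ' φ → ((DG w : Y → V) = smap ρ Γ' (D φ))

/-- The kernel `⟨x|D|y⟩`, as a continuous linear map on `V`. -/
def kernelOfL [FiniteDimensional ℂ V] (D : (Y →₀ V) →ₗ[ℂ] (Y →₀ V)) (x y : Y) : V →L[ℂ] V :=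
  LinearMap.toContinuousLinearMap (kernelOf D x y)

/-- The heat kernel `⟨x|e^{zD}|y⟩ = Σ_{n ≥ 0} (zⁿ/n!) ⟨x|Dⁿ|y⟩`. -/
def heatKer [FiniteDimensional ℂ V] (D : (Y →₀ V) →ₗ[ℂ] (Y →₀ V)) (z : ℂ) (x y : Y) :
    V →L[ℂ] V :=
  ∑' n : ℕ, (z ^ n / (n.factorial : ℂ)) • kernelOfL (D ^ n) x y

/-- The `Γ`-trace `tr_Γ e^{zD} = Σ_{s ∈ S} tr ⟨s|e^{zD}|s⟩`,
for a set `S` of representatives of the `Γ`-orbits. -/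
def trGammaHeat [FiniteDimensional ℂ V] (D : (Y →₀ V) →ₗ[ℂ] (Y →₀ V)) (z : ℂ)
    (S : Set Y) : ℂ :=
  ∑ᶠ s ∈ S, LinearMap.trace ℂ V ((heatKer D z s s : V →L[ℂ] V) : V →ₗ[ℂ] V)

/-- `tr e^{zT}` for an endomorphism `T` of a finite dimensional space,
via the exponential series `Σ_{n ≥ 0} (zⁿ/n!) tr(Tⁿ)`. -/
def trExp {W : Type*} [AddCommGroup W] [Module ℂ W] (T : W →ₗ[ℂ] W) (z : ℂ) : ℂ :=
  ∑' n : ℕ, z ^ n / (n.factorial : ℂ) * LinearMap.trace ℂ W (T ^ n)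

end Defs

section KernelLemmas

variable [NormedAddCommGroup V] [InnerProductSpace ℂ V]

@[simp]
theorem kernelOf_apply (D : (Y →₀ V) →ₗ[ℂ] (Y →₀ V)) (x y : Y) (v : V) :
    kernelOf D x y v = D (Finsupp.single y v) x := rfl

@[simp]
theorem kernelOfL_apply [FiniteDimensional ℂ V] (D : (Y →₀ V) →ₗ[ℂ] (Y →₀ V)) (x y : Y) (v : V) :
    kernelOfL D x y v = D (Finsupp.single y v) x := rfl

theorem secAct_apply_smul [Group Γ] [MulAction Γ Y] (ρ : Γ →* (V ≃ₗᵢ[ℂ] V)) (γ : Γ)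
    (φ : Y →₀ V) (y : Y) : secAct ρ γ φ (γ • y) = ρ γ (φ y) := by
  simp [secAct, Finsupp.equivMapDomain_apply]

theorem secAct_single [Group Γ] [MulAction Γ Y] (ρ : Γ →* (V ≃ₗᵢ[ℂ] V)) (γ : Γ) (y : Y) (v : V) :
    secAct ρ γ (Finsupp.single y v) = Finsupp.single (γ • y) (ρ γ v) := by
  simp [secAct]

/-- An equivariant operator has a kernel whose norm is invariant under the diagonal action. -/
theorem norm_kernelOfL_smul_smul [FiniteDimensional ℂ V] [Group Γ] [MulAction Γ Y]
    {ρ : Γ →* (V ≃ₗᵢ[ℂ] V)} {D : (Y →₀ V) →ₗ[ℂ] (Y →₀ V)} (hinv : IsEquivariantOp ρ D)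
    (γ : Γ) (x y : Y) : ‖kernelOfL D (γ • x) (γ • y)‖ = ‖kernelOfL D x y‖ := by
  have key : ∀ v, kernelOfL D (γ • x) (γ • y) (ρ γ v) = ρ γ (kernelOfL D x y v) := fun v => by
    rw [kernelOfL_apply, ← secAct_single, hinv, secAct_apply_smul, kernelOfL_apply]
  apply le_antisymm
  · refine ContinuousLinearMap.opNorm_le_bound _ (norm_nonneg _) fun v => ?_
    obtain ⟨w, rfl⟩ := (ρ γ).surjective v
    rw [key, LinearIsometryEquiv.norm_map, LinearIsometryEquiv.norm_map]
    exact ContinuousLinearMap.le_opNorm _ _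
  · refine ContinuousLinearMap.opNorm_le_bound _ (norm_nonneg _) fun v => ?_
    rw [← LinearIsometryEquiv.norm_map (ρ γ), ← key, ← LinearIsometryEquiv.norm_map (ρ γ) v]
    exact ContinuousLinearMap.le_opNorm _ _

theorem HasPropSpeed.dist_le [MetricSpace Y] {D : (Y →₀ V) →ₗ[ℂ] (Y →₀ V)} {R : ℝ}
    (h : HasPropSpeed D R) {x y : Y} {v : V} (hv : D (Finsupp.single y v) x ≠ 0) :
    dist x y ≤ R := by
  obtain ⟨w, hw, hd⟩ := h _ _ hv
  rwa [Finset.mem_singleton.1 (Finsupp.support_single_subset hw)] at hd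

theorem kernelOfL_eq_zero [FiniteDimensional ℂ V] [MetricSpace Y]
    {D : (Y →₀ V) →ₗ[ℂ] (Y →₀ V)} {R : ℝ}
    (h : HasPropSpeed D R) {x y : Y} (hd : ¬ dist x y ≤ R) : kernelOfL D x y = 0 := by
  ext v
  by_contra hv
  exact hd (h.dist_le hv)

theorem kernelOfL_pow_succ [FiniteDimensional ℂ V] [MetricSpace Y]
    (hball : ∀ (y : Y) (R : ℝ), (Metric.closedBall y R).Finite)
    {D : (Y →₀ V) →ₗ[ℂ] (Y →₀ V)} {R : ℝ} (h : HasPropSpeed D R) (n : ℕ) (x y : Y) :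
    kernelOfL (D ^ (n + 1)) x y =
      ∑ w ∈ (hball y R).toFinset, (kernelOfL (D ^ n) x w).comp (kernelOfL D w y) := by
  ext v
  have hD : D (Finsupp.single y v) =
      ∑ w ∈ (hball y R).toFinset, Finsupp.single w (D (Finsupp.single y v) w) := by
    nth_rewrite 1 [← Finsupp.sum_single (D (Finsupp.single y v))]
    refine Finsupp.sum_of_support_subset _ (fun w hw => ?_) _ (by simp)
    simpa using h.dist_le (Finsupp.mem_support_iff.1 hw)
  rw [kernelOfL_apply, pow_succ, Module.End.mul_apply, hD, map_sum, Finsupp.finsetSum_apply,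
    _root_.sum_apply]
  rfl

/-- The column sums of the kernel of an equivariant operator of finite propagation speed are
bounded, provided the action is cofinite. -/
theorem exists_sum_norm_kernelOfL_le [FiniteDimensional ℂ V] [MetricSpace Y] [Group Γ]
    [MulAction Γ Y] (hball : ∀ (y : Y) (R : ℝ), (Metric.closedBall y R).Finite)
    (horb : Finite (MulAction.orbitRel.Quotient Γ Y))
    {ρ : Γ →* (V ≃ₗᵢ[ℂ] V)} {D : (Y →₀ V) →ₗ[ℂ] (Y →₀ V)} (hinv : IsEquivariantOp ρ D)
    {R : ℝ} (h : HasPropSpeed D R) :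
    ∃ C : ℝ, 0 ≤ C ∧ ∀ y, ∑ w ∈ (hball y R).toFinset, ‖kernelOfL D w y‖ ≤ C := by
  have hN : ∀ y, ∑' w, ‖kernelOfL D w y‖ = ∑ w ∈ (hball y R).toFinset, ‖kernelOfL D w y‖ :=
    fun y => tsum_eq_sum fun w hw => by
      rw [kernelOfL_eq_zero h (by simpa using hw), norm_zero]
  have hfin : (Set.range fun y => ∑' w, ‖kernelOfL D w y‖).Finite := by
    let g : MulAction.orbitRel.Quotient Γ Y → ℝ :=
      Quotient.lift (fun y => ∑' w, ‖kernelOfL D w y‖) (by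
        rintro _ y ⟨γ, rfl⟩
        simp only
        rw [← Equiv.tsum_eq (MulAction.toPerm γ)]
        exact tsum_congr fun w => norm_kernelOfL_smul_smul hinv γ w y)
    refine (Set.finite_range g).subset ?_
    rintro _ ⟨y, rfl⟩
    exact ⟨Quotient.mk _ y, rfl⟩
  obtain ⟨C, hC⟩ := hfin.bddAbove
  refine ⟨max C 0, le_max_right _ _, fun y => ?_⟩
  rw [← hN]
  exact (hC ⟨y, rfl⟩).trans (le_max_left _ _)

theorem sum_norm_kernelOfL_pow_le [FiniteDimensional ℂ V] [MetricSpace Y]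
    (hball : ∀ (y : Y) (R : ℝ), (Metric.closedBall y R).Finite)
    {D : (Y →₀ V) →ₗ[ℂ] (Y →₀ V)} {R C : ℝ} (h : HasPropSpeed D R) (hC0 : 0 ≤ C)
    (hC : ∀ y, ∑ w ∈ (hball y R).toFinset, ‖kernelOfL D w y‖ ≤ C) (n : ℕ) (y : Y)
    (F : Finset Y) : ∑ x ∈ F, ‖kernelOfL (D ^ n) x y‖ ≤ C ^ n := by
  classical
  induction n generalizing y with
  | zero =>
    have hk : ∀ x, ‖kernelOfL (D ^ 0) x y‖ ≤ if x = y then 1 else 0 := fun x => by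
      split_ifs with hxy
      · refine ContinuousLinearMap.opNorm_le_bound _ zero_le_one fun v => ?_
        simp [hxy]
      · refine ContinuousLinearMap.opNorm_le_bound _ le_rfl fun v => ?_
        simp [Ne.symm hxy]
    refine (Finset.sum_le_sum fun x _ => hk x).trans ?_
    rw [Finset.sum_ite_eq']
    split_ifs <;> simp
  | succ n ih =>
    calc ∑ x ∈ F, ‖kernelOfL (D ^ (n + 1)) x y‖
        ≤ ∑ x ∈ F, ∑ w ∈ (hball y R).toFinset, ‖kernelOfL (D ^ n) x w‖ * ‖kernelOfL D w y‖ := by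
          refine Finset.sum_le_sum fun x _ => ?_
          rw [kernelOfL_pow_succ hball h]
          exact norm_sum_le_of_le _ fun w _ => ContinuousLinearMap.opNorm_comp_le _ _
      _ = ∑ w ∈ (hball y R).toFinset, (∑ x ∈ F, ‖kernelOfL (D ^ n) x w‖) * ‖kernelOfL D w y‖ := by
          rw [Finset.sum_comm]
          simp_rw [Finset.sum_mul]
      _ ≤ ∑ w ∈ (hball y R).toFinset, C ^ n * ‖kernelOfL D w y‖ := by
          gcongr with w
          exact ih w
      _ ≤ C ^ (n + 1) := by
          rw [← Finset.mul_sum, pow_succ]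
          gcongr
          exact hC y

/-- The double series defining the `ℓ¹`-norm of a column of `e^{zD}` converges. -/
theorem summable_norm_heat_terms [FiniteDimensional ℂ V] [MetricSpace Y] [Group Γ]
    [MulAction Γ Y] (hball : ∀ (y : Y) (R : ℝ), (Metric.closedBall y R).Finite)
    (horb : Finite (MulAction.orbitRel.Quotient Γ Y))
    {ρ : Γ →* (V ≃ₗᵢ[ℂ] V)} {D : (Y →₀ V) →ₗ[ℂ] (Y →₀ V)} (hinv : IsEquivariantOp ρ D)
    {R : ℝ} (h : HasPropSpeed D R) (z : ℂ) (y : Y) :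
    Summable fun p : ℕ × Y =>
      ‖(z ^ p.1 / (p.1.factorial : ℂ)) • kernelOfL (D ^ p.1) p.2 y‖ := by
  obtain ⟨C, hC0, hC⟩ := exists_sum_norm_kernelOfL_le hball horb hinv h
  have hbd : ∀ n (F : Finset Y), ∑ x ∈ F, ‖(z ^ n / (n.factorial : ℂ)) • kernelOfL (D ^ n) x y‖ ≤
      (‖z‖ * C) ^ n / n.factorial := fun n F => by
    simp_rw [norm_smul, ← Finset.mul_sum]
    refine (mul_le_mul_of_nonneg_left (sum_norm_kernelOfL_pow_le hball h hC0 hC n y F)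
      (norm_nonneg _)).trans_eq ?_
    simp only [norm_div, norm_pow, Complex.norm_natCast]
    ring
  refine (summable_prod_of_nonneg fun _ => norm_nonneg _).2 ⟨fun n => ?_, ?_⟩
  · exact summable_of_sum_le (fun _ => norm_nonneg _) (hbd n)
  · refine Summable.of_nonneg_of_le (fun n => tsum_nonneg fun _ => norm_nonneg _) (fun n => ?_)
      (Real.summable_pow_div_factorial (‖z‖ * C))
    exact Real.tsum_le_of_sum_le (fun _ => norm_nonneg _) (hbd n)

end KernelLemmas

section Pushdown

variable [NormedAddCommGroup V] [InnerProductSpace ℂ V] [Group Γ] [MulAction Γ Y]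

theorem smap_smul (ρ : Γ →* (V ≃ₗᵢ[ℂ] V)) (Γ' : Subgroup Γ) (φ : Y →₀ V)
    (hφ : ∀ y, (Function.support fun γ : Γ' => ρ ((γ : Γ)⁻¹) (φ ((γ : Γ) • y))).Finite)
    (α : Γ') (y : Y) : smap ρ Γ' φ ((α : Γ) • y) = ρ (α : Γ) (smap ρ Γ' φ y) := by
  unfold smap
  rw [← finsum_comp_equiv (Equiv.mulRight α⁻¹)]
  have := (ρ (α : Γ)).toLinearEquiv.toLinearMap.toAddMonoidHom.map_finsum (hφ y)
  refine Eq.trans (finsum_congr fun γ => ?_) this.symm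
  simp [smul_smul]

theorem smul_left_injective_of_free (hfree : ∀ (γ : Γ) (y : Y), γ • y = y → γ = 1) (y : Y) :
    Function.Injective fun γ : Γ => γ • y := fun a b hab => by
  have : (b⁻¹ * a) • y = y := by
    rw [mul_smul, inv_smul_eq_iff]
    exact hab
  exact (inv_mul_eq_one.1 (hfree _ _ this)).symm

theorem finite_smap_support (hfree : ∀ (γ : Γ) (y : Y), γ • y = y → γ = 1)
    (ρ : Γ →* (V ≃ₗᵢ[ℂ] V)) (Γ' : Subgroup Γ) (φ : Y →₀ V) (y : Y) :
    (Function.support fun γ : Γ' => ρ ((γ : Γ)⁻¹) (φ ((γ : Γ) • y))).Finite := by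
  refine Set.Finite.subset (φ.support.finite_toSet.preimage
    (((smul_left_injective_of_free hfree y).comp Subtype.val_injective).injOn)) fun γ hγ => ?_
  have : φ ((γ : Γ) • y) ≠ 0 := fun h0 => hγ (by simp [h0])
  simpa using this

theorem IsPushdown.pow_apply {ρ : Γ →* (V ≃ₗᵢ[ℂ] V)} {Γ' : Subgroup Γ}
    {D : (Y →₀ V) →ₗ[ℂ] (Y →₀ V)}
    {DG : equivSubmodule (Y := Y) ρ Γ' →ₗ[ℂ] equivSubmodule (Y := Y) ρ Γ'}
    (hDG : IsPushdown ρ Γ' D DG) (n : ℕ) : IsPushdown ρ Γ' (D ^ n) (DG ^ n) := by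
  induction n with
  | zero => exact fun w φ h => h
  | succ n ih =>
    intro w φ h
    rw [pow_succ', pow_succ']
    exact hDG _ _ (ih w φ h)

/-- If `K` is an equivariant integral kernel for a pushdown of `D`, it is obtained from the kernel
of `D` by summation over `Γ'`. -/
theorem kernel_pushdown_apply (hfree : ∀ (γ : Γ) (y : Y), γ • y = y → γ = 1)
    {ρ : Γ →* (V ≃ₗᵢ[ℂ] V)} {Γ' : Subgroup Γ} {D : (Y →₀ V) →ₗ[ℂ] (Y →₀ V)}
    {DG : equivSubmodule (Y := Y) ρ Γ' →ₗ[ℂ] equivSubmodule (Y := Y) ρ Γ'}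
    (hDG : IsPushdown ρ Γ' D DG) {S' : Set Y} (hS' : IsRepSet Γ' S')
    {K : Y → Y → (V →ₗ[ℂ] V)}
    (hK2 : ∀ (γ : Γ') (x y : Y) (v : V),
      K x ((γ : Γ) • y) v = K x y (ρ ((γ : Γ)⁻¹) v))
    (hK3 : ∀ (f : equivSubmodule (Y := Y) ρ Γ') (x : Y),
      (DG f : Y → V) x = ∑ᶠ s ∈ S', K x s ((f : Y → V) s)) (x y : Y) (v : V) :
    K x y v = smap ρ Γ' (D (Finsupp.single y v)) x := by
  classical
  let f : equivSubmodule (Y := Y) ρ Γ' :=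
    ⟨smap ρ Γ' (Finsupp.single y v), smap_smul ρ Γ' _ (finite_smap_support hfree ρ Γ' _)⟩
  obtain ⟨s, ⟨hs, α, hα⟩, huniq⟩ := hS' y
  have hα : (α : Γ) • y = s := hα
  have hfs : (f : Y → V) s = ρ (α : Γ) v := by
    change ∑ᶠ γ : Γ', _ = _
    rw [finsum_eq_single _ α⁻¹]
    · simp [← hα]
    · intro γ hγ
      rw [Finsupp.single_eq_of_ne, map_zero]
      intro h
      apply hγ
      rw [← hα, smul_smul] at h
      have := hfree _ _ h
      exact eq_inv_of_mul_eq_one_left (Subtype.ext this)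
  have hft : ∀ t ∈ S', t ≠ s → (f : Y → V) t = 0 := fun t ht hts => by
    change ∑ᶠ γ : Γ', _ = _
    refine finsum_eq_zero_of_forall_eq_zero fun γ => ?_
    rw [Finsupp.single_eq_of_ne, map_zero]
    intro h
    refine hts (huniq t ⟨ht, γ⁻¹, ?_⟩)
    change ((γ⁻¹ : Γ') : Γ) • y = t
    rw [← h]
    simp
  rw [← hDG f _ rfl, hK3, finsum_eq_single _ s]
  · rw [finsum_eq_if, if_pos hs, hfs, ← hα, hK2]
    simp
  · intro t hts
    rw [finsum_eq_if]
    split_ifs with ht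
    · rw [hft t ht hts, map_zero]
    · rfl

end Pushdown

/-- Let `D` be `Γ`-invariant of finite propagation speed, `Γ'` a finite-index
normal subgroup, `D_{Γ'}` the pushdown of `D`.  Then for every `z ∈ ℂ` and all
`x, y ∈ Y`, the kernel of `e^{zD_{Γ'}}` is
`⟨x|e^{zD_{Γ'}}|y⟩ = Σ_{γ∈Γ'} ρ(γ)⁻¹ ⟨γx|e^{zD}|y⟩`, where
`⟨x|e^{zD_{Γ'}}|y⟩ := Σ_{n≥0} (zⁿ/n!) ⟨x|D_{Γ'}ⁿ|y⟩` and
`⟨x|e^{zD}|y⟩ := Σ_{n≥0} (zⁿ/n!) ⟨x|Dⁿ|y⟩`, all series being absolutely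
convergent.  Here `K n` denotes the kernel of `D_{Γ'}ⁿ`. -/
theorem pushdown_heat_kernel_formula
    [MetricSpace Y] [Group Γ] [MulAction Γ Y]
    [NormedAddCommGroup V] [InnerProductSpace ℂ V] [FiniteDimensional ℂ V]
    (hball : ∀ (y : Y) (R : ℝ), (Metric.closedBall y R).Finite)
    (hiso : ∀ γ : Γ, Isometry (fun y : Y => γ • y))
    (hfree : ∀ (γ : Γ) (y : Y), γ • y = y → γ = 1)
    (horb : Finite (MulAction.orbitRel.Quotient Γ Y))
    (ρ : Γ →* (V ≃ₗᵢ[ℂ] V))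
    (D : (Y →₀ V) →ₗ[ℂ] (Y →₀ V))
    (hinv : IsEquivariantOp ρ D)
    (hprop : ∃ R : ℝ, HasPropSpeed D R)
    (Γ' : Subgroup Γ) (hnorm : Γ'.Normal) (hfi : Γ'.FiniteIndex)
    (DG : equivSubmodule (Y := Y) ρ Γ' →ₗ[ℂ] equivSubmodule (Y := Y) ρ Γ')
    (hDG : IsPushdown ρ Γ' D DG)
    (S' : Set Y) (hS' : IsRepSet Γ' S')
    (K : ℕ → Y → Y → (V →ₗ[ℂ] V))
    (hK1 : ∀ (n : ℕ) (γ : Γ') (x y : Y) (v : V),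
      K n ((γ : Γ) • x) y v = ρ (γ : Γ) (K n x y v))
    (hK2 : ∀ (n : ℕ) (γ : Γ') (x y : Y) (v : V),
      K n x ((γ : Γ) • y) v = K n x y (ρ ((γ : Γ)⁻¹) v))
    (hK3 : ∀ (n : ℕ) (f : equivSubmodule (Y := Y) ρ Γ') (x : Y),
      ((DG ^ n) f : Y → V) x = ∑ᶠ s ∈ S', K n x s ((f : Y → V) s)) :
    ∀ (z : ℂ) (x y : Y),
      Summable (fun n : ℕ => ‖(z ^ n / (n.factorial : ℂ)) • kernelOfL (D ^ n) x y‖) ∧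
      Summable (fun n : ℕ =>
        ‖(z ^ n / (n.factorial : ℂ)) • LinearMap.toContinuousLinearMap (K n x y)‖) ∧
      Summable (fun γ : Γ' =>
        ‖((ρ ((γ : Γ)⁻¹)).toLinearIsometry.toContinuousLinearMap).comp
            (heatKer D z ((γ : Γ) • x) y)‖) ∧
      (∑' n : ℕ, (z ^ n / (n.factorial : ℂ)) • LinearMap.toContinuousLinearMap (K n x y)) =
        ∑' γ : Γ', ((ρ ((γ : Γ)⁻¹)).toLinearIsometry.toContinuousLinearMap).comp
          (heatKer D z ((γ : Γ) • x) y) := by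
  intro z x y
  obtain ⟨R, hR⟩ := hprop
  have : CompleteSpace V := FiniteDimensional.complete ℂ V
  have hY := summable_norm_heat_terms hball horb hinv hR z y
  let r : Γ' → (V →L[ℂ] V) := fun γ =>
    (ρ ((γ : Γ)⁻¹)).toLinearIsometry.toContinuousLinearMap
  let a : ℕ → Y → (V →L[ℂ] V) := fun n w =>
    (z ^ n / (n.factorial : ℂ)) • kernelOfL (D ^ n) w y
  let G : ℕ → Γ' → (V →L[ℂ] V) := fun n γ => (r γ).comp (a n ((γ : Γ) • x))
  have hinj : Function.Injective fun γ : Γ' => (γ : Γ) • x :=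
    (smul_left_injective_of_free hfree x).comp Subtype.val_injective
  have ha : ∀ w, Summable fun n => ‖a n w‖ := fun w =>
    hY.comp_injective (i := fun n : ℕ => (n, w)) fun _ _ h => congrArg Prod.fst h
  have hG : Summable fun p : ℕ × Γ' => ‖G p.1 p.2‖ := by
    have hinj' : Function.Injective fun p : ℕ × Γ' => (p.1, (p.2 : Γ) • x) :=
      Function.injective_id.prodMap hinj
    refine Summable.of_nonneg_of_le (fun _ => norm_nonneg _) (fun p => ?_)
      (hY.comp_injective hinj')
    exact (LinearIsometry.norm_toContinuousLinearMap_comp _).le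
  have hGn : ∀ n, HasSum (G n)
      ((z ^ n / (n.factorial : ℂ)) • LinearMap.toContinuousLinearMap (K n x y)) := fun n => by
    have hs : Summable (G n) := (hG.prod_factor n).of_norm
    convert hs.hasSum using 1
    ext v
    have hv := (ContinuousLinearMap.apply ℂ V v).map_tsum hs
    simp only [ContinuousLinearMap.apply_apply] at hv
    rw [hv, tsum_eq_finsum]
    · rw [_root_.smul_apply, LinearMap.coe_toContinuousLinearMap',
        kernel_pushdown_apply hfree (hDG.pow_apply n) hS' (hK2 n) (hK3 n), smap,
        smul_finsum' _ (finite_smap_support hfree ρ Γ' _ _)]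
      exact finsum_congr fun γ => by simp [G, r, a]
    · refine (finite_smap_support hfree ρ Γ' ((D ^ n) (Finsupp.single y v)) x).subset ?_
      intro γ hγ h0
      refine hγ ?_
      simp only at h0
      simp [G, r, a] at h0 ⊢
      simp [h0]
  have hGγ : ∀ γ : Γ', HasSum (fun n => G n γ) ((r γ).comp (heatKer D z ((γ : Γ) • x) y)) :=
    fun γ => (ContinuousLinearMap.compL ℂ V V V (r γ)).hasSum (ha _).of_norm.hasSum
  refine ⟨ha x, ?_, ?_, ?_⟩
  · refine Summable.of_nonneg_of_le (fun _ => norm_nonneg _) (fun n => ?_) hG.prod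
    rw [← (hGn n).tsum_eq]
    exact norm_tsum_le_tsum_norm (hG.prod_factor n)
  · refine Summable.of_nonneg_of_le (fun _ => norm_nonneg _) (fun γ => ?_) hG.prod_symm.prod
    refine (congrArg norm (hGγ γ).tsum_eq.symm).trans_le ?_
    exact norm_tsum_le_tsum_norm (hG.prod_symm.prod_factor γ)
  · calc _ = ∑' n, ∑' γ, G n γ := tsum_congr fun n => (hGn n).tsum_eq.symm
      _ = ∑' γ, ∑' n, G n γ := hG.of_norm.tsum_comm.symm
      _ = _ := tsum_congr fun γ => (hGγ γ).tsum_eq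
end
end

section
/- Let D be a Γ-invariant linear operator on compactly supported sections of finite propagation speed and (Γ_j) a tower in Γ. Then there exist constants C₁, C₂ > 0 such that for all j ∈ ℕ and all z ∈ ℂ: |tr_Γ e^{zD}| ≤ C₁·e^{C₂|z|} and |tr e^{zD_{Γ_j}}|/[Γ:Γ_j] ≤ C₁·e^{C₂|z|}. -/
open scoped BigOperators
open Filter

noncomputable section

variable {Y Γ V : Type*}

/-- A bound on all eigenvalues of an endomorphism bounds its trace. -/
theorem norm_trace_le_of_eigenvalue_bound {W : Type*} [AddCommGroup W] [Module ℂ W]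
    [FiniteDimensional ℂ W] (T : Module.End ℂ W) {c : ℝ}
    (h : ∀ (μ : ℂ) (w : W), w ≠ 0 → T w = μ • w → ‖μ‖ ≤ c) :
    ‖LinearMap.trace ℂ W T‖ ≤ Module.finrank ℂ W * c := by
  have hsplit : T.charpoly.Splits := IsAlgClosed.splits _
  rw [Module.End.trace_eq_sum_roots_charpoly_of_splits hsplit]
  refine (norm_multiset_sum_le _).trans ?_
  have hcard : (T.charpoly.roots.map norm).card = Module.finrank ℂ W := by
    rw [Multiset.card_map, ← LinearMap.charpoly_natDegree (R := ℂ) (M := W) T,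
      hsplit.natDegree_eq_card_roots]
  rw [← hcard, ← nsmul_eq_mul]
  refine Multiset.sum_le_card_nsmul _ _ fun x hx => ?_
  obtain ⟨μ, hμ, rfl⟩ := Multiset.mem_map.mp hx
  obtain ⟨w, hw⟩ := ((Module.End.hasEigenvalue_iff_isRoot_charpoly T μ).mpr
    (Polynomial.isRoot_of_mem_roots hμ)).exists_hasEigenvector
  exact h μ w hw.2 hw.apply_eq_smul

theorem norm_tsum_pow_div_factorial_smul_le {E : Type*} [NormedAddCommGroup E]
    [NormedSpace ℂ E] {a : ℕ → E} {K M : ℝ} (h : ∀ n, ‖a n‖ ≤ K * M ^ n) (z : ℂ) :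
    ‖∑' n : ℕ, (z ^ n / (n.factorial : ℂ)) • a n‖ ≤ K * Real.exp (M * ‖z‖) := by
  have hexp := (NormedSpace.expSeries_div_hasSum_exp (M * ‖z‖)).mul_left K
  rw [← Real.exp_eq_exp_ℝ] at hexp
  refine tsum_of_norm_bounded hexp fun n => ?_
  rw [norm_smul, norm_div, norm_pow, Complex.norm_natCast]
  calc ‖z‖ ^ n / n.factorial * ‖a n‖ ≤ ‖z‖ ^ n / n.factorial * (K * M ^ n) := by
        gcongr
        exact h n
    _ = K * ((M * ‖z‖) ^ n / n.factorial) := by ring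

section Group

variable [Group Γ] [MulAction Γ Y]

theorem IsRepSet.finite [Finite (MulAction.orbitRel.Quotient Γ Y)] {S : Set Y}
    (hS : IsRepSet Γ S) : S.Finite := by
  have hinj : Function.Injective
      fun s : S => (Quotient.mk _ (s : Y) : MulAction.orbitRel.Quotient Γ Y) := by
    intro s t hst
    have hmem : (s : Y) ∈ MulAction.orbit Γ (t : Y) :=
      MulAction.orbitRel_apply.mp (Quotient.exact hst)
    exact Subtype.ext ((hS t).unique ⟨s.2, hmem⟩ ⟨t.2, MulAction.mem_orbit_self _⟩)
  exact Set.finite_coe_iff.mp (Finite.of_injective _ hinj)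

/-- The points `q⁻¹ • s`, for `s` in a set of representatives of the `Γ`-orbits and `q` in a set
of representatives of the left cosets of `Γ'`, meet every `Γ'`-orbit. -/
theorem IsRepSet.exists_subgroup_smul {S : Set Y} (hS : IsRepSet Γ S) (Γ' : Subgroup Γ) (y : Y) :
    ∃ (i : S × (Γ ⧸ Γ')) (γ : Γ'), y = (γ : Γ) • ((Quotient.out i.2 : Γ)⁻¹ • (i.1 : Y)) := by
  obtain ⟨s, ⟨hs, g, rfl⟩, -⟩ := hS y
  refine ⟨(⟨_, hs⟩, (g : Γ ⧸ Γ')), ?_⟩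
  have hmem : g⁻¹ * Quotient.out (g : Γ ⧸ Γ') ∈ Γ' :=
    QuotientGroup.eq.mp (QuotientGroup.out_eq' _).symm
  exact ⟨⟨_, hmem⟩, by simp [mul_smul]⟩

theorem finite_setOf_smul_mem (hfree : ∀ (γ : Γ) (y : Y), γ • y = y → γ = 1) (Γ' : Subgroup Γ)
    {s t : Set Y} (hs : s.Finite) (ht : t.Finite) :
    {γ : Γ' | ∃ y ∈ s, (γ : Γ) • y ∈ t}.Finite := by
  have hpt : ∀ y u : Y, {γ : Γ' | (γ : Γ) • y = u}.Finite := by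
    refine fun y u => Set.Subsingleton.finite fun γ hγ δ hδ => ?_
    have hγδ : ((δ : Γ)⁻¹ * γ) • y = y := by
      rw [mul_smul, Set.mem_ofPred_eq.mp hγ, ← Set.mem_ofPred_eq.mp hδ, inv_smul_smul]
    exact Subtype.ext (inv_mul_eq_one.mp (hfree _ _ hγδ)).symm
  refine (hs.biUnion fun y _ => ht.biUnion fun u _ => hpt y u).subset ?_
  rintro γ ⟨y, hy, hγ⟩
  simp only [Set.mem_iUnion]
  exact ⟨y, hy, _, hγ, rfl⟩

variable [NormedAddCommGroup V] [InnerProductSpace ℂ V]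

theorem secAct_apply (ρ : Γ →* (V ≃ₗᵢ[ℂ] V)) (γ : Γ) (φ : Y →₀ V) (y : Y) :
    secAct ρ γ φ y = ρ γ (φ (γ⁻¹ • y)) := by
  simp [secAct, Finsupp.equivMapDomain_apply]

theorem norm_equivSubmodule_smul {ρ : Γ →* (V ≃ₗᵢ[ℂ] V)} {Γ' : Subgroup Γ}
    (f : equivSubmodule (Y := Y) ρ Γ') (γ : Γ') (y : Y) :
    ‖(f : Y → V) ((γ : Γ) • y)‖ = ‖(f : Y → V) y‖ := by
  rw [f.2 γ y, LinearIsometryEquiv.norm_map]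

/-- Restriction of an equivariant function to a set of representatives of the `Γ'`-orbits. -/
def equivSubmoduleRestrict (ρ : Γ →* (V ≃ₗᵢ[ℂ] V)) (Γ' : Subgroup Γ) (S : Set Y) :
    equivSubmodule (Y := Y) ρ Γ' →ₗ[ℂ] (S × (Γ ⧸ Γ') → V) :=
  LinearMap.funLeft ℂ V (fun i : S × (Γ ⧸ Γ') => (Quotient.out i.2 : Γ)⁻¹ • (i.1 : Y)) ∘ₗ
    (equivSubmodule (Y := Y) ρ Γ').subtype

theorem equivSubmoduleRestrict_injective (ρ : Γ →* (V ≃ₗᵢ[ℂ] V)) (Γ' : Subgroup Γ) {S : Set Y}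
    (hS : IsRepSet Γ S) : Function.Injective (equivSubmoduleRestrict ρ Γ' S) := by
  intro f g hfg
  ext y
  obtain ⟨i, γ, rfl⟩ := hS.exists_subgroup_smul Γ' y
  rw [f.2, g.2]
  exact congrArg (ρ (γ : Γ)) (congrFun hfg i)

theorem equivSubmodule_finiteDimensional [FiniteDimensional ℂ V] (ρ : Γ →* (V ≃ₗᵢ[ℂ] V))
    (Γ' : Subgroup Γ) [Γ'.FiniteIndex] {S : Set Y} (hS : IsRepSet Γ S) (hSf : S.Finite) :
    FiniteDimensional ℂ (equivSubmodule (Y := Y) ρ Γ') := by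
  have := hSf.to_subtype
  exact Module.Finite.of_injective _ (equivSubmoduleRestrict_injective ρ Γ' hS)

theorem finrank_equivSubmodule_le [FiniteDimensional ℂ V] (ρ : Γ →* (V ≃ₗᵢ[ℂ] V))
    (Γ' : Subgroup Γ) [Γ'.FiniteIndex] {S : Set Y} (hS : IsRepSet Γ S) (hSf : S.Finite) :
    Module.finrank ℂ (equivSubmodule (Y := Y) ρ Γ') ≤
      S.ncard * Γ'.index * Module.finrank ℂ V := by
  have := hSf.to_subtype
  have := Fintype.ofFinite (S × (Γ ⧸ Γ'))
  refine (LinearMap.finrank_le_finrank_of_injective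
    (equivSubmoduleRestrict_injective ρ Γ' hS)).trans_eq ?_
  rw [Module.finrank_pi_fintype, Finset.sum_const, Finset.card_univ, ← Nat.card_eq_fintype_card,
    Nat.card_prod, smul_eq_mul, Nat.card_coe_set_eq, Subgroup.index]

/-- The summation map is onto the space of equivariant functions. -/
theorem exists_smap_eq (hfree : ∀ (γ : Γ) (y : Y), γ • y = y → γ = 1)
    (ρ : Γ →* (V ≃ₗᵢ[ℂ] V)) (Γ' : Subgroup Γ) [Γ'.FiniteIndex] {S : Set Y}
    (hS : IsRepSet Γ S) (hSf : S.Finite) (f : equivSubmodule (Y := Y) ρ Γ') :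
    ∃ φ : Y →₀ V, (f : Y → V) = smap ρ Γ' φ := by
  classical
  have := hSf.to_subtype
  have hfin : Finite (MulAction.orbitRel.Quotient Γ' Y) := by
    refine Finite.of_surjective (fun i : S × (Γ ⧸ Γ') =>
      (Quotient.mk _ ((Quotient.out i.2 : Γ)⁻¹ • (i.1 : Y)) :
        MulAction.orbitRel.Quotient Γ' Y)) fun q => ?_
    obtain ⟨y, rfl⟩ := Quotient.exists_rep q
    obtain ⟨i, γ, hi⟩ := hS.exists_subgroup_smul Γ' y
    refine ⟨i, (Quotient.sound (MulAction.orbitRel_apply.mpr ⟨γ, ?_⟩)).symm⟩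
    exact hi.symm
  have hF := Set.finite_range (Quotient.out : MulAction.orbitRel.Quotient Γ' Y → Y)
  set F := hF.toFinset with hFdef
  have hmemF : ∀ y, y ∈ F ↔ ∃ q : MulAction.orbitRel.Quotient Γ' Y, q.out = y := by
    simp [hFdef]
  refine ⟨Finsupp.onFinset F (fun y => if y ∈ F then (f : Y → V) y else 0) (by
    intro y hy
    by_contra hyF
    simp [hyF] at hy), ?_⟩
  funext y
  obtain ⟨γ₀, hγ₀⟩ : ∃ γ : Γ', γ • y = (Quotient.mk _ y : MulAction.orbitRel.Quotient Γ' Y).out :=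
    MulAction.orbitRel_apply.mp (Quotient.mk_out (s := MulAction.orbitRel Γ' Y) y)
  have hγ₀F : (γ₀ : Γ) • y ∈ F := (hmemF _).mpr ⟨_, hγ₀.symm⟩
  rw [smap, finsum_eq_single _ γ₀]
  · rw [Finsupp.onFinset_apply, if_pos hγ₀F, f.2 γ₀ y, map_inv]
    exact ((ρ (γ₀ : Γ)).symm_apply_apply _).symm
  · intro γ hγ
    rw [Finsupp.onFinset_apply, if_neg, map_zero]
    intro hγF
    obtain ⟨q, hq⟩ := (hmemF _).mp hγF
    have hqy : q = Quotient.mk _ y := by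
      rw [← Quotient.out_eq q]
      exact Quotient.sound (MulAction.orbitRel_apply.mpr ⟨γ, hq.symm⟩)
    have heq : (γ : Γ) • y = (γ₀ : Γ) • y := by
      rw [← hq, hqy]
      exact hγ₀.symm
    have hstab : ((γ₀ : Γ)⁻¹ * γ) • y = y := by rw [mul_smul, heq, inv_smul_smul]
    exact hγ (Subtype.ext (inv_mul_eq_one.mp (hfree _ _ hstab)).symm)

theorem smap_eq_sum_secAct (ρ : Γ →* (V ≃ₗᵢ[ℂ] V)) (Γ' : Subgroup Γ) (φ : Y →₀ V) (y : Y)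
    {A : Finset Γ'} (hA : ∀ γ : Γ', φ ((γ : Γ) • y) ≠ 0 → γ ∈ A) :
    smap ρ Γ' φ y = (∑ γ ∈ A, secAct ρ ((γ : Γ)⁻¹) φ) y := by
  rw [smap, finsum_eq_sum_of_support_subset (s := A), Finsupp.finsetSum_apply]
  · exact Finset.sum_congr rfl fun γ _ => by rw [secAct_apply, inv_inv]
  · intro γ hγ
    refine hA γ fun h0 => hγ ?_
    simp only [h0, map_zero]

end Group

section Bound

variable [MetricSpace Y] [Group Γ] [MulAction Γ Y]
variable [NormedAddCommGroup V] [InnerProductSpace ℂ V]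

/-- `M` bounds `D` in the supremum norm, locally on balls of radius `R`. -/
def IsLocalSupBound (D : (Y →₀ V) →ₗ[ℂ] (Y →₀ V)) (R M : ℝ) : Prop :=
  ∀ (φ : Y →₀ V) (x : Y) (B : ℝ), 0 ≤ B → (∀ y, dist x y ≤ R → ‖φ y‖ ≤ B) → ‖D φ x‖ ≤ M * B

theorem norm_apply_le_sum_norm_kernel [FiniteDimensional ℂ V]
    {D : (Y →₀ V) →ₗ[ℂ] (Y →₀ V)} {R : ℝ}
    (hD : HasPropSpeed D R) (x : Y) (hx : (Metric.closedBall x R).Finite)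
    (φ : Y →₀ V) {B : ℝ} (hφ : ∀ y, dist x y ≤ R → ‖φ y‖ ≤ B) :
    ‖D φ x‖ ≤ (∑ y ∈ hx.toFinset, ‖kernelOfL D x y‖) * B := by
  classical
  set ψ : Y →₀ V := ∑ y ∈ hx.toFinset, Finsupp.single y (φ y) with hψ
  have hψ_apply : ∀ y, dist x y ≤ R → (φ - ψ) y = 0 := by
    intro y hy
    have hmem : y ∈ hx.toFinset := by simpa [dist_comm] using hy
    simp [hψ, Finsupp.single_apply, dist_comm y x, hy]
  have hzero : D (φ - ψ) x = 0 := by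
    by_contra hne
    obtain ⟨y, hy, hxy⟩ := hD _ _ hne
    exact Finsupp.mem_support_iff.mp hy (hψ_apply y hxy)
  rw [map_sub, Finsupp.sub_apply, sub_eq_zero] at hzero
  rw [hzero, hψ, map_sum, Finsupp.finsetSum_apply, Finset.sum_mul]
  refine norm_sum_le_of_le _ fun y hy => ?_
  have hy' : dist x y ≤ R := by simpa [dist_comm] using hy
  refine ((kernelOfL D x y).le_opNorm (φ y)).trans ?_
  gcongr
  exact hφ y hy'

theorem exists_isLocalSupBound [FiniteDimensional ℂ V]
    (hball : ∀ (y : Y) (R : ℝ), (Metric.closedBall y R).Finite)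
    (hiso : ∀ γ : Γ, Isometry (fun y : Y => γ • y)) {ρ : Γ →* (V ≃ₗᵢ[ℂ] V)}
    {D : (Y →₀ V) →ₗ[ℂ] (Y →₀ V)} (hinv : IsEquivariantOp ρ D) {R : ℝ} (hD : HasPropSpeed D R)
    {S : Set Y} (hS : IsRepSet Γ S) (hSf : S.Finite) :
    ∃ M : ℝ, 0 ≤ M ∧ IsLocalSupBound D R M := by
  set m : Y → ℝ := fun s => ∑ y ∈ (hball s R).toFinset, ‖kernelOfL D s y‖
  have hm : ∀ s, 0 ≤ m s := fun s => Finset.sum_nonneg fun _ _ => norm_nonneg _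
  refine ⟨∑ s ∈ hSf.toFinset, m s, Finset.sum_nonneg fun s _ => hm s, ?_⟩
  intro φ x B hB hφ
  obtain ⟨s, ⟨hs, g, rfl⟩, -⟩ := hS x
  have htranslate : ‖D φ x‖ = ‖D (secAct ρ g φ) (g • x)‖ := by
    rw [hinv, secAct_apply, inv_smul_smul, LinearIsometryEquiv.norm_map]
  rw [htranslate]
  refine (norm_apply_le_sum_norm_kernel hD (g • x) (hball _ R) (secAct ρ g φ) (B := B) ?_).trans ?_
  · intro y hy
    rw [secAct_apply, LinearIsometryEquiv.norm_map]
    refine hφ _ ?_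
    rwa [← (hiso g).dist_eq, smul_inv_smul]
  · refine mul_le_mul_of_nonneg_right ?_ hB
    exact Finset.single_le_sum (f := m) (fun s _ => hm s) (hSf.mem_toFinset.mpr hs)

theorem IsLocalSupBound.norm_pow_apply_le {D : (Y →₀ V) →ₗ[ℂ] (Y →₀ V)} {R M : ℝ}
    (hM : IsLocalSupBound D R M) (hM0 : 0 ≤ M) (n : ℕ) {φ : Y →₀ V} {B : ℝ} (hB : 0 ≤ B)
    (hφ : ∀ y, ‖φ y‖ ≤ B) (x : Y) : ‖(D ^ n) φ x‖ ≤ M ^ n * B := by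
  induction n generalizing x with
  | zero => simpa using hφ x
  | succ n ih =>
    rw [pow_succ', Module.End.mul_apply, pow_succ', mul_assoc]
    exact hM _ x _ (by positivity) fun y _ => ih y

theorem IsLocalSupBound.norm_kernelOfL_pow_le [FiniteDimensional ℂ V]
    {D : (Y →₀ V) →ₗ[ℂ] (Y →₀ V)} {R M : ℝ}
    (hM : IsLocalSupBound D R M) (hM0 : 0 ≤ M) (n : ℕ) (x y : Y) :
    ‖kernelOfL (D ^ n) x y‖ ≤ M ^ n := by
  classical
  refine ContinuousLinearMap.opNorm_le_bound _ (by positivity) fun v => ?_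
  refine hM.norm_pow_apply_le hM0 n (φ := Finsupp.single y v) (norm_nonneg v) (fun u => ?_) x
  rw [Finsupp.single_apply]
  split_ifs <;> simp

theorem norm_trace_le_finrank_mul_opNorm [FiniteDimensional ℂ V] (A : V →L[ℂ] V) :
    ‖LinearMap.trace ℂ V (A : V →ₗ[ℂ] V)‖ ≤ Module.finrank ℂ V * ‖A‖ := by
  refine norm_trace_le_of_eigenvalue_bound _ fun μ v hv hμ => ?_
  have hle := A.le_opNorm v
  rw [← ContinuousLinearMap.coe_coe A, hμ, norm_smul] at hle
  exact le_of_mul_le_mul_right hle (norm_pos_iff.mpr hv)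

theorem IsLocalSupBound.norm_trGammaHeat_le [FiniteDimensional ℂ V]
    {D : (Y →₀ V) →ₗ[ℂ] (Y →₀ V)} {R M : ℝ}
    (hM : IsLocalSupBound D R M) (hM0 : 0 ≤ M) {S : Set Y} (hSf : S.Finite) (z : ℂ) :
    ‖trGammaHeat D z S‖ ≤ S.ncard * Module.finrank ℂ V * Real.exp (M * ‖z‖) := by
  rw [trGammaHeat, finsum_mem_eq_finite_toFinset_sum _ hSf, Set.ncard_eq_toFinset_card _ hSf,
    mul_assoc, ← nsmul_eq_mul, ← Finset.sum_const]
  refine norm_sum_le_of_le _ fun s _ => (norm_trace_le_finrank_mul_opNorm _).trans ?_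
  gcongr
  have h := norm_tsum_pow_div_factorial_smul_le (a := fun n => kernelOfL (D ^ n) s s) (K := 1)
    (M := M) (fun n => by simpa using hM.norm_kernelOfL_pow_le hM0 n s s) z
  rwa [one_mul] at h

theorem IsLocalSupBound.norm_pushdown_apply_le
    (hball : ∀ (y : Y) (R : ℝ), (Metric.closedBall y R).Finite)
    (hfree : ∀ (γ : Γ) (y : Y), γ • y = y → γ = 1) {ρ : Γ →* (V ≃ₗᵢ[ℂ] V)}
    {D : (Y →₀ V) →ₗ[ℂ] (Y →₀ V)} (hinv : IsEquivariantOp ρ D) {R M : ℝ}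
    (hM : IsLocalSupBound D R M) {S : Set Y} (hS : IsRepSet Γ S) (hSf : S.Finite)
    {Γ' : Subgroup Γ} [Γ'.FiniteIndex]
    {T : equivSubmodule (Y := Y) ρ Γ' →ₗ[ℂ] equivSubmodule (Y := Y) ρ Γ'}
    (hT : IsPushdown ρ Γ' D T) (f : equivSubmodule (Y := Y) ρ Γ') {B : ℝ} (hB : 0 ≤ B)
    (hf : ∀ y, ‖(f : Y → V) y‖ ≤ B) (x : Y) : ‖(T f : Y → V) x‖ ≤ M * B := by
  obtain ⟨φ, hφ⟩ := exists_smap_eq hfree ρ Γ' hS hSf f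
  have hAfin := finite_setOf_smul_mem hfree Γ' ((hball x R).insert x)
    (φ.support.finite_toSet.union (D φ).support.finite_toSet)
  set A := hAfin.toFinset with hA
  have hmemA : ∀ (γ : Γ') (y : Y), (y = x ∨ dist x y ≤ R) →
      (φ ((γ : Γ) • y) ≠ 0 ∨ D φ ((γ : Γ) • y) ≠ 0) → γ ∈ A := by
    intro γ y hy hγ
    rw [hA, Set.Finite.mem_toFinset]
    refine ⟨y, ?_, ?_⟩
    · simpa [dist_comm] using hy
    · simpa using hγ
  rw [hT f φ hφ, smap_eq_sum_secAct ρ Γ' (D φ) x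
    (fun γ hγ => hmemA γ x (Or.inl rfl) (Or.inr hγ))]
  simp_rw [← hinv _ φ]
  rw [← map_sum]
  refine hM _ x B hB fun y hy => ?_
  rw [← smap_eq_sum_secAct ρ Γ' φ y (fun γ hγ => hmemA γ y (Or.inr hy) (Or.inl hγ)), ← hφ]
  exact hf y

theorem IsLocalSupBound.norm_trace_pushdown_pow_le [FiniteDimensional ℂ V]
    (hball : ∀ (y : Y) (R : ℝ), (Metric.closedBall y R).Finite)
    (hfree : ∀ (γ : Γ) (y : Y), γ • y = y → γ = 1) {ρ : Γ →* (V ≃ₗᵢ[ℂ] V)}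
    {D : (Y →₀ V) →ₗ[ℂ] (Y →₀ V)} (hinv : IsEquivariantOp ρ D) {R M : ℝ}
    (hM : IsLocalSupBound D R M) (hM0 : 0 ≤ M) {S : Set Y} (hS : IsRepSet Γ S) (hSf : S.Finite)
    {Γ' : Subgroup Γ} [Γ'.FiniteIndex]
    {T : equivSubmodule (Y := Y) ρ Γ' →ₗ[ℂ] equivSubmodule (Y := Y) ρ Γ'}
    (hT : IsPushdown ρ Γ' D T) (n : ℕ) :
    ‖LinearMap.trace ℂ _ (T ^ n)‖ ≤
      Module.finrank ℂ (equivSubmodule (Y := Y) ρ Γ') * M ^ n := by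
  have := hSf.to_subtype
  have := equivSubmodule_finiteDimensional ρ Γ' hS hSf
  refine norm_trace_le_of_eigenvalue_bound _ fun μ f hf hμ => ?_
  obtain ⟨y₀, hy₀⟩ : ∃ y, (f : Y → V) y ≠ 0 := by
    by_contra! h
    exact hf (Subtype.ext (funext h))
  have : Nonempty (S × (Γ ⧸ Γ')) := ⟨(hS.exists_subgroup_smul Γ' y₀).choose⟩
  obtain ⟨i, hi⟩ := Finite.exists_max fun i : S × (Γ ⧸ Γ') =>
    ‖(f : Y → V) ((Quotient.out i.2 : Γ)⁻¹ • (i.1 : Y))‖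
  set y₁ := (Quotient.out i.2 : Γ)⁻¹ • (i.1 : Y)
  have hmax : ∀ y, ‖(f : Y → V) y‖ ≤ ‖(f : Y → V) y₁‖ := by
    intro y
    obtain ⟨k, γ, rfl⟩ := hS.exists_subgroup_smul Γ' y
    rw [norm_equivSubmodule_smul]
    exact hi k
  have hpow : ∀ (k : ℕ) (y : Y), ‖((T ^ k) f : Y → V) y‖ ≤ M ^ k * ‖(f : Y → V) y₁‖ := by
    intro k
    induction k with
    | zero => simpa using hmax
    | succ k ih =>
      intro y
      rw [pow_succ', Module.End.mul_apply, pow_succ', mul_assoc]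
      exact hM.norm_pushdown_apply_le hball hfree hinv hS hSf hT _ (by positivity) ih y
  have hle := hpow n y₁
  rw [hμ, Submodule.coe_smul, Pi.smul_apply, norm_smul] at hle
  exact le_of_mul_le_mul_right hle ((norm_pos_iff.mpr hy₀).trans_le (hmax y₀))

theorem IsLocalSupBound.norm_trExp_div_index_le [FiniteDimensional ℂ V]
    (hball : ∀ (y : Y) (R : ℝ), (Metric.closedBall y R).Finite)
    (hfree : ∀ (γ : Γ) (y : Y), γ • y = y → γ = 1) {ρ : Γ →* (V ≃ₗᵢ[ℂ] V)}
    {D : (Y →₀ V) →ₗ[ℂ] (Y →₀ V)} (hinv : IsEquivariantOp ρ D) {R M : ℝ}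
    (hM : IsLocalSupBound D R M) (hM0 : 0 ≤ M) {S : Set Y} (hS : IsRepSet Γ S) (hSf : S.Finite)
    {Γ' : Subgroup Γ} [Γ'.FiniteIndex]
    {T : equivSubmodule (Y := Y) ρ Γ' →ₗ[ℂ] equivSubmodule (Y := Y) ρ Γ'}
    (hT : IsPushdown ρ Γ' D T) (z : ℂ) :
    ‖trExp T z‖ / (Γ'.index : ℝ) ≤ S.ncard * Module.finrank ℂ V * Real.exp (M * ‖z‖) := by
  have hindex : (0 : ℝ) < Γ'.index :=
    Nat.cast_pos.mpr (Nat.pos_of_ne_zero Subgroup.FiniteIndex.index_ne_zero)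
  have hdim : (Module.finrank ℂ (equivSubmodule (Y := Y) ρ Γ') : ℝ) ≤
      S.ncard * Γ'.index * Module.finrank ℂ V :=
    mod_cast finrank_equivSubmodule_le ρ Γ' hS hSf
  rw [div_le_iff₀ hindex]
  calc ‖trExp T z‖ ≤ Module.finrank ℂ (equivSubmodule (Y := Y) ρ Γ') * Real.exp (M * ‖z‖) :=
        norm_tsum_pow_div_factorial_smul_le
          (hM.norm_trace_pushdown_pow_le hball hfree hinv hM0 hS hSf hT) z
    _ ≤ S.ncard * Γ'.index * Module.finrank ℂ V * Real.exp (M * ‖z‖) := by gcongr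
    _ = S.ncard * Module.finrank ℂ V * Real.exp (M * ‖z‖) * Γ'.index := by ring

end Bound

/-- Let `D` be `Γ`-invariant of finite propagation speed and `(Γ_j)` a tower in
`Γ`.  Then there are constants `C₁, C₂ > 0` such that for all `j` and all `z ∈ ℂ`:
`|tr_Γ e^{zD}| ≤ C₁ e^{C₂|z|}` and `|tr e^{zD_{Γ_j}}|/[Γ:Γ_j] ≤ C₁ e^{C₂|z|}`. -/
theorem heat_trace_exponential_bound
    [MetricSpace Y] [Group Γ] [MulAction Γ Y]
    [NormedAddCommGroup V] [InnerProductSpace ℂ V] [FiniteDimensional ℂ V]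
    (hball : ∀ (y : Y) (R : ℝ), (Metric.closedBall y R).Finite)
    (hiso : ∀ γ : Γ, Isometry (fun y : Y => γ • y))
    (hfree : ∀ (γ : Γ) (y : Y), γ • y = y → γ = 1)
    (horb : Finite (MulAction.orbitRel.Quotient Γ Y))
    (ρ : Γ →* (V ≃ₗᵢ[ℂ] V))
    (D : (Y →₀ V) →ₗ[ℂ] (Y →₀ V))
    (hinv : IsEquivariantOp ρ D)
    (hprop : ∃ R : ℝ, HasPropSpeed D R)
    (Γs : ℕ → Subgroup Γ) (htop : Γs 0 = ⊤)
    (hdec : ∀ j, Γs (j + 1) ≤ Γs j)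
    (hnorm : ∀ j, (Γs j).Normal) (hfi : ∀ j, (Γs j).FiniteIndex)
    (hinter : (⨅ j, Γs j) = ⊥)
    (DG : ∀ j, equivSubmodule (Y := Y) ρ (Γs j) →ₗ[ℂ] equivSubmodule (Y := Y) ρ (Γs j))
    (hDG : ∀ j, IsPushdown ρ (Γs j) D (DG j))
    (S : Set Y) (hS : IsRepSet Γ S) :
    ∃ C₁ C₂ : ℝ, 0 < C₁ ∧ 0 < C₂ ∧
      ∀ (j : ℕ) (z : ℂ),
        ‖trGammaHeat D z S‖ ≤ C₁ * Real.exp (C₂ * ‖z‖) ∧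
        ‖trExp (DG j) z‖ / ((Γs j).index : ℝ) ≤ C₁ * Real.exp (C₂ * ‖z‖) := by
  obtain ⟨R, hR⟩ := hprop
  have hSf := hS.finite
  obtain ⟨M, hM0, hM⟩ := exists_isLocalSupBound hball hiso hinv hR hS hSf
  have hmono : ∀ z : ℂ, S.ncard * Module.finrank ℂ V * Real.exp (M * ‖z‖) ≤
      (S.ncard * Module.finrank ℂ V + 1) * Real.exp ((M + 1) * ‖z‖) := by
    intro z
    gcongr <;> linarith
  refine ⟨S.ncard * Module.finrank ℂ V + 1, M + 1, by positivity, by positivity, fun j z => ?_⟩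
  have := hfi j
  exact ⟨(hM.norm_trGammaHeat_le hM0 hSf z).trans (hmono z),
    (hM.norm_trExp_div_index_le hball hfree hinv hM0 hS hSf (hDG j) z).trans (hmono z)⟩
end
end
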